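/- For every n ∈ ℕ, the closure of X_n in E(𝓕) is a nowhere dense subset of the subspace cl(X_{n+1}) of E(𝓕); equivalently, every point of X_n is the limit of a sequence of points of X_{n+1} \ cl(X_n). -/

import Mathlib

noncomputable section
open Topology Filter TopologicalSpace

/- The dynamical model: F(t) = 3^t − 1 acting on ℝ × ℤ^ω (ℤ discrete, product topology). -/

/-- `F t = 3 ^ t - 1` (real exponent). -/
def F : ℝ → ℝ := fun t => (3 : ℝ) ^ t - 1

/-- The inverse of `F` on `[0, ∞)`: `F⁻¹ t = log₃ (t + 1)`. -/
def Finv : ℝ → ℝ := fun t => Real.logb 3 (t + 1)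

/-- The shift map on integer sequences. -/
def shift : (ℕ → ℤ) → (ℕ → ℤ) := fun s n => s (n + 1)

/-- The map 𝓕(t, s) = (F(t) − |s₀|, σ(s)). -/
def calF : ℝ × (ℕ → ℤ) → ℝ × (ℕ → ℤ) :=
  fun x => (F x.1 - (|x.2 0| : ℝ), shift x.2)

/-- J(𝓕) = {x : T(𝓕ⁿ(x)) ≥ 0 for all n ≥ 0} (the case n = 0 forces T(x) ≥ 0). -/
def J : Set (ℝ × (ℕ → ℤ)) := {x | ∀ n : ℕ, 0 ≤ (calF^[n] x).1}

/-- 𝕊 = {s ∈ ℤ^ω : (t, s) ∈ J(𝓕) for some t ≥ 0}. -/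
def Sset : Set (ℕ → ℤ) := {s | ∃ t : ℝ, 0 ≤ t ∧ (t, s) ∈ J}

/-- t_s = min {t ≥ 0 : (t, s) ∈ J(𝓕)} (as an infimum; for s ∈ 𝕊 it is attained). -/
def tmin (s : ℕ → ℤ) : ℝ := sInf {t : ℝ | (t, s) ∈ J}

/-- The endpoint set E(𝓕) = {(t_s, s) : s ∈ 𝕊}, a subspace of ℝ × ℤ^ω. -/
def Efan : Set (ℝ × (ℕ → ℤ)) := {x | x.2 ∈ Sset ∧ x.1 = tmin x.2}

/-- t*_s = sup_{k ≥ 1} F^{−k}(|s_k|). -/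
def tstar (s : ℕ → ℤ) : ℝ := ⨆ k : ℕ, Finv^[k + 1] (|s (k + 1)| : ℝ)

/-- X_n = {x ∈ E(𝓕) : t*_{σ^{2k²}(s(x))} > F^{k−n}(1) for all k > n}. -/
def Xfan (n : ℕ) : Set ↥Efan :=
  {x | ∀ k : ℕ, n < k → F^[k - n] 1 < tstar (shift^[2 * k ^ 2] (x : ℝ × (ℕ → ℤ)).2)}

theorem F_Finv {x : ℝ} (hx : 0 ≤ x) : F (Finv x) = x := by
  have h : (0 : ℝ) < x + 1 := by linarith
  simp [F, Finv, Real.rpow_logb, h]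

theorem Finv_F (x : ℝ) : Finv (F x) = x := by
  simp [F, Finv, Real.logb_rpow]

theorem F_mono : Monotone F := fun _ _ h =>
  sub_le_sub_right (Real.rpow_le_rpow_of_exponent_le (by norm_num) h) 1

theorem F_strictMono : StrictMono F := fun _ _ h =>
  sub_lt_sub_right (Real.rpow_lt_rpow_of_exponent_lt (by norm_num) h) 1

theorem Finv_nonneg {x : ℝ} (hx : 0 ≤ x) : 0 ≤ Finv x :=
  Real.logb_nonneg (by norm_num) (by linarith)

theorem Finv_le_iff {x y : ℝ} (hx : 0 ≤ x) : Finv x ≤ y ↔ x ≤ F y := by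
  rw [← F_strictMono.le_iff_le, F_Finv hx]

theorem lt_Finv_iff {x y : ℝ} (hx : 0 ≤ x) : y < Finv x ↔ F y < x := by
  rw [← F_strictMono.lt_iff_lt, F_Finv hx]

theorem Finv_mono {x y : ℝ} (hx : 0 ≤ x) (h : x ≤ y) : Finv x ≤ Finv y := by
  rw [Finv_le_iff hx, F_Finv (hx.trans h)]; exact h

theorem Finv_add_le {x y : ℝ} (hx : 0 ≤ x) (hy : 0 ≤ y) : Finv (x + y) ≤ Finv x + Finv y := by
  unfold Finv
  rw [← Real.logb_mul (by linarith) (by linarith)]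
  exact Real.logb_le_logb_of_le (by norm_num) (by linarith) (by nlinarith [mul_nonneg hx hy])

theorem one_lt_log_three : 1 < Real.log 3 := by
  rw [Real.lt_log_iff_exp_lt (by norm_num)]
  linarith [Real.exp_one_lt_d9]

theorem Finv_le_mul {x : ℝ} (hx : 0 ≤ x) : Finv x ≤ (Real.log 3)⁻¹ * x := by
  have h := Real.log_le_sub_one_of_pos (show (0 : ℝ) < x + 1 by linarith)
  have h3 := one_lt_log_three
  rw [Finv, Real.logb, div_eq_inv_mul]
  gcongr
  linarith

theorem Finv_iterate_nonneg {x : ℝ} (hx : 0 ≤ x) (k : ℕ) : 0 ≤ Finv^[k] x := by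
  induction k with
  | zero => exact hx
  | succ k ih => rw [Function.iterate_succ_apply']; exact Finv_nonneg ih

theorem Finv_iterate_mono {x y : ℝ} (hx : 0 ≤ x) (h : x ≤ y) (k : ℕ) :
    Finv^[k] x ≤ Finv^[k] y := by
  induction k with
  | zero => exact h
  | succ k ih =>
    rw [Function.iterate_succ_apply', Function.iterate_succ_apply']
    exact Finv_mono (Finv_iterate_nonneg hx k) ih

theorem Finv_iterate_le_pow {x : ℝ} (hx : 0 ≤ x) (k : ℕ) :
    Finv^[k] x ≤ (Real.log 3)⁻¹ ^ k * x := by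
  have h3 := one_lt_log_three
  induction k with
  | zero => simp
  | succ k ih =>
    rw [Function.iterate_succ_apply', pow_succ', mul_assoc]
    refine (Finv_le_mul (Finv_iterate_nonneg hx k)).trans ?_
    gcongr

/-- The orbit of `1` under `F`, as a sequence of natural numbers. -/
def tower : ℕ → ℕ
  | 0 => 1
  | k + 1 => 3 ^ tower k - 1

theorem tower_succ_add_one (k : ℕ) : tower (k + 1) + 1 = 3 ^ tower k :=
  Nat.sub_add_cancel (Nat.one_le_pow _ _ (by norm_num))

theorem F_tower (k : ℕ) : F (tower k) = tower (k + 1) := by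
  have h : ((tower (k + 1) + 1 : ℕ) : ℝ) = ((3 ^ tower k : ℕ) : ℝ) :=
    congrArg _ (tower_succ_add_one k)
  push_cast at h
  rw [F, Real.rpow_natCast]
  linarith

theorem F_tower_add_one (k : ℕ) : F (tower k + 1) = 3 * tower (k + 1) + 2 := by
  have h := F_tower k
  rw [F] at h ⊢
  rw [Real.rpow_add_one (by norm_num)]
  linarith

theorem F_iterate_one (k : ℕ) : F^[k] 1 = tower k := by
  induction k with
  | zero => simp [tower]
  | succ k ih => rw [Function.iterate_succ_apply', ih, F_tower]

theorem one_le_tower (k : ℕ) : 1 ≤ tower k := by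
  induction k with
  | zero => exact le_rfl
  | succ k ih =>
    have h : 3 ^ 1 ≤ 3 ^ tower k := Nat.pow_le_pow_right (by norm_num) ih
    have := tower_succ_add_one k
    omega

theorem tower_mul_two_le (k : ℕ) : tower k * 2 ≤ tower (k + 1) := by
  have h := one_add_le_pow_of_two_add_nonneg (a := (2 : ℕ)) (Nat.zero_le _) (tower k)
  have := tower_succ_add_one k
  norm_num at h
  omega

theorem tower_strictMono : StrictMono tower := by
  refine strictMono_nat_of_lt_succ fun k => ?_
  have := tower_mul_two_le k
  have := one_le_tower k
  omega

theorem tower_add_one_lt {k : ℕ} (hk : 1 ≤ k) : tower k + 1 < tower (k + 1) := by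
  have := tower_mul_two_le k
  have : 1 < tower k := tower_strictMono (show 0 < k by omega)
  omega

theorem tower_lt_of_lt_Finv_iterate {z : ℝ} (hz : 0 ≤ z) {q : ℕ} (i : ℕ)
    (h : (tower q : ℝ) < Finv^[i] z) : (tower (q + i) : ℝ) < z := by
  induction i generalizing q with
  | zero => exact h
  | succ i ih =>
    rw [Function.iterate_succ_apply', lt_Finv_iff (Finv_iterate_nonneg hz i), F_tower] at h
    have := ih h
    rwa [show q + 1 + i = q + (i + 1) by omega] at this

theorem Finv_iterate_tower (i q : ℕ) : Finv^[i + q] (tower q) = Finv^[i] 1 := by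
  induction q with
  | zero => simp [tower]
  | succ q ih =>
    rw [← add_assoc, Function.iterate_succ_apply, ← F_tower, Finv_F, ih]

theorem shift_iterate_apply (s : ℕ → ℤ) (i k : ℕ) : shift^[i] s k = s (i + k) := by
  induction i generalizing s with
  | zero => simp
  | succ i ih => rw [Function.iterate_succ_apply, ih, shift]; congr 1; omega

theorem calF_iterate_snd (x : ℝ × (ℕ → ℤ)) (i : ℕ) : (calF^[i] x).2 = shift^[i] x.2 := by
  induction i generalizing x with
  | zero => rfl
  | succ i ih => rw [Function.iterate_succ_apply, ih]; rfl

theorem calF_iterate_fst_mono (s : ℕ → ℤ) (i : ℕ) {a b : ℝ} (h : a ≤ b) :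
    (calF^[i] (a, s)).1 ≤ (calF^[i] (b, s)).1 := by
  induction i generalizing s a b with
  | zero => exact h
  | succ i ih =>
    rw [Function.iterate_succ_apply, Function.iterate_succ_apply]
    exact ih _ (sub_le_sub_right (F_mono h) _)

theorem continuous_calF : Continuous calF := by
  unfold calF F shift
  have h : Continuous fun z : ℤ => (|z| : ℝ) := continuous_of_discreteTopology
  refine Continuous.prodMk ?_ (continuous_pi fun n => by fun_prop)
  refine ((continuous_const.rpow continuous_fst fun _ => Or.inl (by norm_num)).sub
    continuous_const).sub ?_
  exact h.comp ((continuous_apply 0).comp continuous_snd)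

theorem isClosed_J : IsClosed J := by
  rw [show J = ⋂ n : ℕ, {x | 0 ≤ (calF^[n] x).1} by ext; simp [J]]
  exact isClosed_iInter fun n =>
    isClosed_le continuous_const (continuous_fst.comp (continuous_calF.iterate n))

theorem fst_nonneg_of_mem_J {x : ℝ × (ℕ → ℤ)} (hx : x ∈ J) : 0 ≤ x.1 := hx 0

theorem calF_mem_J {x : ℝ × (ℕ → ℤ)} (hx : x ∈ J) : calF x ∈ J := fun n => by
  rw [← Function.iterate_succ_apply]; exact hx (n + 1)

theorem calF_iterate_mem_J {x : ℝ × (ℕ → ℤ)} (hx : x ∈ J) (i : ℕ) : calF^[i] x ∈ J := by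
  induction i with
  | zero => exact hx
  | succ i ih => rw [Function.iterate_succ_apply']; exact calF_mem_J ih

theorem bddBelow_fiber_J (s : ℕ → ℤ) : BddBelow {t : ℝ | (t, s) ∈ J} :=
  ⟨0, fun _ ht => fst_nonneg_of_mem_J ht⟩

theorem tmin_le {t : ℝ} {s : ℕ → ℤ} (h : (t, s) ∈ J) : tmin s ≤ t :=
  csInf_le (bddBelow_fiber_J s) h

theorem tmin_mem_J {s : ℕ → ℤ} (hs : s ∈ Sset) : (tmin s, s) ∈ J := by
  obtain ⟨t, -, ht⟩ := hs
  have hc : IsClosed {t : ℝ | (t, s) ∈ J} :=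
    isClosed_J.preimage (continuous_id.prodMk continuous_const)
  exact hc.csInf_mem ⟨t, ht⟩ (bddBelow_fiber_J s)

theorem mem_J_of_mem_Efan {x : ℝ × (ℕ → ℤ)} (hx : x ∈ Efan) : x ∈ J := by
  have h := tmin_mem_J hx.1
  rwa [← hx.2] at h

theorem Finv_iterate_le_fst {y : ℝ × (ℕ → ℤ)} (hy : y ∈ J) (k : ℕ) :
    Finv^[k + 1] (|y.2 k| : ℝ) ≤ y.1 := by
  induction k generalizing y with
  | zero =>
    have h : 0 ≤ F y.1 - (|y.2 0| : ℝ) := hy 1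
    exact (Finv_le_iff (abs_nonneg _)).2 (by linarith)
  | succ k ih =>
    have h : Finv^[k + 1] (|y.2 (k + 1)| : ℝ) ≤ F y.1 - (|y.2 0| : ℝ) := ih (calF_mem_J hy)
    rw [Function.iterate_succ_apply', Finv_le_iff (Finv_iterate_nonneg (abs_nonneg _) _)]
    linarith [abs_nonneg (y.2 0 : ℝ)]

theorem Finv_iterate_le_calF_iterate {x : ℝ × (ℕ → ℤ)} (hx : x ∈ J) (i k : ℕ) :
    Finv^[k + 1] (|shift^[i] x.2 (k + 1)| : ℝ) ≤ (calF^[i + 1] x).1 := by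
  have h := Finv_iterate_le_fst (calF_iterate_mem_J hx (i + 1)) k
  rw [calF_iterate_snd, shift_iterate_apply, show i + 1 + k = i + (k + 1) by omega] at h
  rwa [shift_iterate_apply]

theorem tstar_le_calF_iterate {x : ℝ × (ℕ → ℤ)} (hx : x ∈ J) (i : ℕ) :
    tstar (shift^[i] x.2) ≤ (calF^[i + 1] x).1 :=
  ciSup_le (Finv_iterate_le_calF_iterate hx i)

theorem le_tstar {x : ℝ × (ℕ → ℤ)} (hx : x ∈ J) (i k : ℕ) :
    Finv^[k + 1] (|shift^[i] x.2 (k + 1)| : ℝ) ≤ tstar (shift^[i] x.2) :=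
  le_ciSup (f := fun k : ℕ => Finv^[k + 1] (|shift^[i] x.2 (k + 1)| : ℝ))
    ⟨_, Set.forall_mem_range.2 (Finv_iterate_le_calF_iterate hx i)⟩ k

/-- The time whose orbit along `s` reaches `b` after `N` steps. -/
def pull : ℕ → (ℕ → ℤ) → ℝ → ℝ
  | 0, _, b => b
  | N + 1, s, b => Finv (|(s 0 : ℝ)| + pull N (shift s) b)

theorem pull_nonneg (N : ℕ) (s : ℕ → ℤ) {b : ℝ} (hb : 0 ≤ b) : 0 ≤ pull N s b := by
  induction N generalizing s with
  | zero => exact hb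
  | succ N ih => exact Finv_nonneg (add_nonneg (abs_nonneg _) (ih _))

theorem calF_pull_succ (N : ℕ) (s : ℕ → ℤ) {b : ℝ} (hb : 0 ≤ b) :
    calF (pull (N + 1) s b, s) = (pull N (shift s) b, shift s) := by
  simp [calF, pull, F_Finv (add_nonneg (abs_nonneg (s 0 : ℝ)) (pull_nonneg N (shift s) hb))]

theorem calF_iterate_pull (N i : ℕ) (s : ℕ → ℤ) {b : ℝ} (hb : 0 ≤ b) :
    calF^[i] (pull (N + i) s b, s) = (pull N (shift^[i] s) b, shift^[i] s) := by
  induction i generalizing s with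
  | zero => rfl
  | succ i ih =>
    rw [Function.iterate_succ_apply, ← add_assoc, calF_pull_succ _ _ hb, ih,
      Function.iterate_succ_apply]

theorem pull_mem_J (N : ℕ) (s : ℕ → ℤ) {b : ℝ} (h : (b, shift^[N] s) ∈ J) :
    (pull N s b, s) ∈ J := by
  have hb : 0 ≤ b := fst_nonneg_of_mem_J h
  intro i
  rcases le_total i N with hi | hi
  · obtain ⟨M, rfl⟩ := Nat.exists_eq_add_of_le' hi
    rw [calF_iterate_pull M i s hb]
    exact pull_nonneg _ _ hb
  · obtain ⟨M, rfl⟩ := Nat.exists_eq_add_of_le' hi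
    have h0 := calF_iterate_pull 0 N s hb
    rw [zero_add] at h0
    rw [Function.iterate_add_apply, h0]
    exact h M

theorem pull_zero_le {x : ℝ × (ℕ → ℤ)} (hx : x ∈ J) (N : ℕ) : pull N x.2 0 ≤ x.1 := by
  induction N generalizing x with
  | zero => exact fst_nonneg_of_mem_J hx
  | succ N ih =>
    have h : pull N (shift x.2) 0 ≤ F x.1 - (|x.2 0| : ℝ) := ih (calF_mem_J hx)
    rw [pull, Finv_le_iff (add_nonneg (abs_nonneg _) (pull_nonneg _ _ le_rfl))]
    linarith

theorem pull_le_add (N : ℕ) (s : ℕ → ℤ) {b : ℝ} (hb : 0 ≤ b) :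
    pull N s b ≤ pull N s 0 + Finv^[N] b := by
  induction N generalizing s with
  | zero => simp [pull]
  | succ N ih =>
    have h0 : 0 ≤ |(s 0 : ℝ)| + pull N (shift s) 0 :=
      add_nonneg (abs_nonneg _) (pull_nonneg _ _ le_rfl)
    rw [Function.iterate_succ_apply', pull, pull]
    refine le_trans ?_ (Finv_add_le h0 (Finv_iterate_nonneg hb N))
    refine Finv_mono (add_nonneg (abs_nonneg _) (pull_nonneg _ _ hb)) ?_
    linarith [ih (shift s)]

theorem pull_congr {N : ℕ} {s s' : ℕ → ℤ} (h : ∀ i < N, s i = s' i) (b : ℝ) :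
    pull N s b = pull N s' b := by
  induction N generalizing s s' with
  | zero => rfl
  | succ N ih =>
    rw [pull, pull, h 0 (by omega), ih (s := shift s) (s' := shift s') fun i hi => h (i + 1) (by omega)]

theorem tendsto_pull_zero {s : ℕ → ℤ} (hs : s ∈ Sset) :
    Tendsto (fun N => pull N s 0) atTop (𝓝 (tmin s)) := by
  refine tendsto_order.2 ⟨fun a ha => ?_, fun a ha =>
    Eventually.of_forall fun N => (pull_zero_le (tmin_mem_J hs) N).trans_lt ha⟩
  have hJ : (a, s) ∉ J := fun h => (tmin_le h).not_gt ha
  simp only [J, Set.mem_ofPred_eq, not_forall, not_le] at hJ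
  obtain ⟨i, hi⟩ := hJ
  filter_upwards [eventually_ge_atTop i] with N hN
  by_contra! hle
  obtain ⟨M, rfl⟩ := Nat.exists_eq_add_of_le' hN
  have h := calF_iterate_fst_mono s i hle
  rw [calF_iterate_pull M i s le_rfl] at h
  exact (pull_nonneg M (shift^[i] s) le_rfl).not_gt (h.trans_lt hi)

theorem mem_J_of_supersolution {w : ℕ → ℤ} {b : ℕ → ℝ} (hb : ∀ i, 0 ≤ b i)
    (h : ∀ i, b (i + 1) + |(w i : ℝ)| ≤ F (b i)) : (b 0, w) ∈ J := by
  have key : ∀ i, b i ≤ (calF^[i] (b 0, w)).1 := by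
    intro i
    induction i with
    | zero => exact le_rfl
    | succ i ih =>
      have h2 : (calF^[i] (b 0, w)).2 0 = w i := by
        rw [calF_iterate_snd, shift_iterate_apply]; rfl
      rw [Function.iterate_succ_apply', calF, h2]
      linarith [F_mono ih, h i]
  exact fun i => (hb i).trans (key i)

/-- Replace the entries of `s` after position `N` by `tower (q + 1) + 1, tower (q + 2) + 1, …`. -/
def graft (s : ℕ → ℤ) (N q : ℕ) : ℕ → ℤ :=
  fun i => if i ≤ N then s i else tower (q + (i - N)) + 1

theorem graft_of_le {s : ℕ → ℤ} {N q i : ℕ} (h : i ≤ N) : graft s N q i = s i := if_pos h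

theorem graft_of_lt {s : ℕ → ℤ} {N q i : ℕ} (h : N < i) :
    graft s N q i = tower (q + (i - N)) + 1 := if_neg h.not_ge

theorem graft_tail_mem_J (s : ℕ → ℤ) (N q : ℕ) :
    ((tower q + 1 : ℝ), shift^[N + 1] (graft s N q)) ∈ J := by
  refine mem_J_of_supersolution (b := fun i => (tower (q + i) + 1 : ℝ))
    (fun i => by positivity) fun i => ?_
  rw [shift_iterate_apply, graft_of_lt (by omega), F_tower_add_one,
    show q + (N + 1 + i - N) = q + i + 1 by omega]
  push_cast
  rw [abs_of_nonneg (by positivity), ← add_assoc q i 1]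
  linarith [Nat.cast_nonneg (α := ℝ) (tower (q + i + 1))]

theorem graft_mem_J (s : ℕ → ℤ) (N q : ℕ) :
    (pull (N + 1) (graft s N q) (tower q + 1), graft s N q) ∈ J :=
  pull_mem_J _ _ (graft_tail_mem_J s N q)

theorem graft_mem_Sset (s : ℕ → ℤ) (N q : ℕ) : graft s N q ∈ Sset :=
  ⟨_, fst_nonneg_of_mem_J (graft_mem_J s N q), graft_mem_J s N q⟩

/-- The endpoint of `Efan` with address `graft s N q`. -/
def graftPoint (s : ℕ → ℤ) (N q : ℕ) : ↥Efan :=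
  ⟨(tmin (graft s N q), graft s N q), graft_mem_Sset s N q, rfl⟩

theorem calF_iterate_graftPoint_le (s : ℕ → ℤ) (N q : ℕ) :
    (calF^[N + 1] (graftPoint s N q : ℝ × (ℕ → ℤ))).1 ≤ tower q + 1 := by
  have h := calF_iterate_fst_mono (graft s N q) (N + 1) (tmin_le (graft_mem_J s N q))
  have h0 := calF_iterate_pull 0 (N + 1) (graft s N q) (b := tower q + 1) (by positivity)
  rw [zero_add] at h0
  rw [h0] at h
  exact h

theorem pull_le_tmin_graft (s : ℕ → ℤ) (N q : ℕ) : pull (N + 1) s 0 ≤ tmin (graft s N q) := by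
  rw [pull_congr fun i hi => (graft_of_le (q := q) (by omega : i ≤ N)).symm]
  exact pull_zero_le (tmin_mem_J (graft_mem_Sset s N q)) (N + 1)

theorem tmin_graft_le {N q m : ℕ} (s : ℕ → ℤ) (hN : m + (q + 1) ≤ N + 1) (hq : 1 ≤ q) :
    tmin (graft s N q) ≤ pull (N + 1) s 0 + (Real.log 3)⁻¹ ^ m := by
  have hlog := one_lt_log_three
  have hb : ((tower q + 1 : ℕ) : ℝ) ≤ tower (q + 1) := by exact_mod_cast (tower_add_one_lt hq).le
  push_cast at hb
  refine (tmin_le (graft_mem_J s N q)).trans ((pull_le_add _ _ (by positivity)).trans ?_)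
  rw [pull_congr fun i hi => graft_of_le (q := q) (by omega : i ≤ N)]
  gcongr
  refine (Finv_iterate_mono (by positivity) hb _).trans ?_
  rw [show N + 1 = (N + 1 - (q + 1)) + (q + 1) by omega, Finv_iterate_tower]
  refine (Finv_iterate_le_pow zero_le_one _).trans ?_
  rw [mul_one]
  exact pow_le_pow_of_le_one (by positivity) (inv_le_one_of_one_le₀ hlog.le) (by omega)

theorem tendsto_graftPoint (x : ↥Efan) {N q : ℕ → ℕ} (hq : ∀ K, 1 ≤ q K)
    (hN : ∀ K, K + q K ≤ N K) :
    Tendsto (fun K => graftPoint (x : ℝ × (ℕ → ℤ)).2 (N K) (q K)) atTop (𝓝 x) := by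
  obtain ⟨⟨t, s⟩, hs, rfl : t = tmin s⟩ := x
  have hlog := one_lt_log_three
  have hNtop : Tendsto N atTop atTop :=
    tendsto_atTop_mono (fun K => (Nat.le_add_right K (q K)).trans (hN K)) tendsto_id
  have hpull : Tendsto (fun K => pull (N K + 1) s 0) atTop (𝓝 (tmin s)) :=
    (tendsto_pull_zero hs).comp ((tendsto_add_atTop_nat 1).comp hNtop)
  have hpow : Tendsto (fun K : ℕ => (Real.log 3)⁻¹ ^ K) atTop (𝓝 0) :=
    tendsto_pow_atTop_nhds_zero_of_lt_one (by positivity) (inv_lt_one_of_one_lt₀ hlog)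
  rw [tendsto_subtype_rng]
  refine Tendsto.prodMk_nhds ?_ (tendsto_pi_nhds.2 fun i => ?_)
  · refine tendsto_of_tendsto_of_tendsto_of_le_of_le hpull
      (by simpa using hpull.add hpow) (fun K => pull_le_tmin_graft s _ _)
      (fun K => tmin_graft_le s (by have := hN K; omega) (hq K))
  · refine tendsto_const_nhds.congr' ?_
    filter_upwards [hNtop.eventually_ge_atTop i] with K hK
    exact (graft_of_le hK).symm

/-- At a cut level `m`, the inequalities defining `Xfan n` for levels `k < m` are witnessed by
entries of `s` at positions at most `2 * m ^ 2`. -/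
def IsCutLevel (n : ℕ) (s : ℕ → ℤ) (m : ℕ) : Prop :=
  ∀ k, n < k → k < m → ∃ l, 2 * k ^ 2 < l ∧ l ≤ 2 * m ^ 2 ∧
    (tower (k - n) : ℝ) < Finv^[l - 2 * k ^ 2] (|s l| : ℝ)

theorem exists_witness {n : ℕ} {x : ↥Efan} (hx : x ∈ Xfan n) {k : ℕ} (hk : n < k) :
    ∃ l, 2 * k ^ 2 < l ∧
      (tower (k - n) : ℝ) < Finv^[l - 2 * k ^ 2] (|(x : ℝ × (ℕ → ℤ)).2 l| : ℝ) := by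
  obtain ⟨j, hj⟩ := exists_lt_of_lt_ciSup (hx k hk)
  rw [F_iterate_one, shift_iterate_apply] at hj
  refine ⟨2 * k ^ 2 + (j + 1), by omega, ?_⟩
  rwa [Nat.add_sub_cancel_left]

theorem witness_of_le {n m k l : ℕ} {z : ℝ} (hz : 0 ≤ z) (hnm : n < m) (hmk : m ≤ k)
    (hkl : 2 * k ^ 2 < l) (h : (tower (m - n) : ℝ) < Finv^[l - 2 * m ^ 2] z) :
    (tower (k - n) : ℝ) < Finv^[l - 2 * k ^ 2] z := by
  obtain ⟨d, rfl⟩ := Nat.exists_eq_add_of_le hmk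
  have hsq : 2 * m ^ 2 + d ≤ 2 * (m + d) ^ 2 := by nlinarith [Nat.zero_le (m * d)]
  rw [show l - 2 * m ^ 2 = (2 * (m + d) ^ 2 - 2 * m ^ 2) + (l - 2 * (m + d) ^ 2) by omega,
    Function.iterate_add_apply] at h
  refine lt_of_le_of_lt ?_ (tower_lt_of_lt_Finv_iterate (Finv_iterate_nonneg hz _) _ h)
  exact_mod_cast tower_strictMono.monotone (by omega)

theorem exists_isCutLevel {n : ℕ} {x : ↥Efan} (hx : x ∈ Xfan n) (K : ℕ) :
    ∃ m, n + 1 + K ≤ m ∧ IsCutLevel n (x : ℝ × (ℕ → ℤ)).2 m := by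
  induction K with
  | zero => exact ⟨n + 1, le_rfl, fun k h1 h2 => by omega⟩
  | succ K ih =>
    obtain ⟨m, hm, hcut⟩ := ih
    obtain ⟨l, hl, hw⟩ := exists_witness hx (show n < m by omega)
    have hex : ∃ r, l ≤ 2 * r ^ 2 := ⟨l, by nlinarith⟩
    classical
    have hspec : l ≤ 2 * Nat.find hex ^ 2 := Nat.find_spec hex
    have hmr : m < Nat.find hex := by
      by_contra! h
      have := Nat.pow_le_pow_left h 2
      omega
    refine ⟨Nat.find hex, by omega, fun k hnk hkr => ?_⟩
    rcases lt_or_ge k m with hkm | hmk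
    · obtain ⟨l', h1, h2, h3⟩ := hcut k hnk hkm
      exact ⟨l', h1, by omega, h3⟩
    · have hkl : 2 * k ^ 2 < l := not_le.1 (Nat.find_min hex hkr)
      exact ⟨l, hkl, hspec, witness_of_le (abs_nonneg _) (by omega) hmk hkl hw⟩

theorem graftPoint_mem_Xfan {n m : ℕ} {s : ℕ → ℤ} (hnm : n + 1 < m) (hcut : IsCutLevel n s m) :
    graftPoint s (2 * m ^ 2) (m - n - 1) ∈ Xfan (n + 1) := by
  intro k hk
  set s' := graft s (2 * m ^ 2) (m - n - 1) with hs'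
  rw [F_iterate_one]
  have hle : ∀ l, 2 * k ^ 2 < l → Finv^[l - 2 * k ^ 2] (|s' l| : ℝ) ≤
      tstar (shift^[2 * k ^ 2] s') := by
    intro l hl
    have h := le_tstar (tmin_mem_J (graft_mem_Sset s (2 * m ^ 2) (m - n - 1))) (2 * k ^ 2)
      (l - 2 * k ^ 2 - 1)
    rw [shift_iterate_apply, show l - 2 * k ^ 2 - 1 + 1 = l - 2 * k ^ 2 by omega,
      show 2 * k ^ 2 + (l - 2 * k ^ 2) = l by omega] at h
    exact h
  rcases lt_or_ge k m with hkm | hmk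
  · obtain ⟨l, h1, h2, h3⟩ := hcut k (by omega) hkm
    have h4 := hle l h1
    rw [hs', graft_of_le h2] at h4
    refine lt_of_le_of_lt ?_ (h3.trans_le h4)
    exact_mod_cast tower_strictMono.monotone (by omega)
  · have h4 := hle (2 * k ^ 2 + 1) (by omega)
    have hsq : 2 * m ^ 2 + (k - m) ≤ 2 * k ^ 2 := by
      obtain ⟨d, rfl⟩ := Nat.exists_eq_add_of_le hmk
      rw [Nat.add_sub_cancel_left]
      nlinarith [Nat.zero_le (m * d)]
    rw [Nat.add_sub_cancel_left, Function.iterate_one, hs', graft_of_lt (by omega)] at h4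
    refine lt_of_lt_of_le ?_ h4
    rw [lt_Finv_iff (abs_nonneg _), F_tower]
    have hmono : tower (k - (n + 1) + 1) ≤ tower (m - n - 1 + (2 * k ^ 2 + 1 - 2 * m ^ 2)) :=
      tower_strictMono.monotone (by omega)
    have hmono' : ((tower (k - (n + 1) + 1) : ℕ) : ℝ) ≤
        (tower (m - n - 1 + (2 * k ^ 2 + 1 - 2 * m ^ 2)) : ℕ) := Nat.cast_le.2 hmono
    push_cast
    exact lt_of_lt_of_le (by linarith) (le_abs_self _)

theorem tower_le_of_mem_closure_Xfan {n k : ℕ} (hk : n < k) {x : ↥Efan}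
    (hx : x ∈ closure (Xfan n)) :
    (tower (k - n) : ℝ) ≤ (calF^[2 * k ^ 2 + 1] (x : ℝ × (ℕ → ℤ))).1 := by
  have hc : IsClosed {x : ↥Efan |
      (tower (k - n) : ℝ) ≤ (calF^[2 * k ^ 2 + 1] (x : ℝ × (ℕ → ℤ))).1} :=
    isClosed_le continuous_const
      (continuous_fst.comp ((continuous_calF.iterate _).comp continuous_subtype_val))
  refine closure_minimal (fun y hy => ?_) hc hx
  have h := hy k hk
  rw [F_iterate_one] at h
  exact h.le.trans (tstar_le_calF_iterate (mem_J_of_mem_Efan y.2) _)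

theorem graftPoint_notMem_closure_Xfan {n m : ℕ} (s : ℕ → ℤ) (hnm : n + 1 < m) :
    graftPoint s (2 * m ^ 2) (m - n - 1) ∉ closure (Xfan n) := by
  intro h
  have h1 := tower_le_of_mem_closure_Xfan (show n < m by omega) h
  have h2 := calF_iterate_graftPoint_le s (2 * m ^ 2) (m - n - 1)
  have h3 := tower_add_one_lt (show 1 ≤ m - n - 1 by omega)
  rw [show m - n - 1 + 1 = m - n by omega] at h3
  have h4 : ((tower (m - n - 1) + 1 : ℕ) : ℝ) < tower (m - n) := Nat.cast_lt.2 h3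
  push_cast at h4
  linarith

theorem exists_seq_tendsto_of_mem_Xfan {n : ℕ} {x : ↥Efan} (hx : x ∈ Xfan n) :
    ∃ u : ℕ → ↥Efan, (∀ m, u m ∈ Xfan (n + 1) \ closure (Xfan n)) ∧
      Tendsto u atTop (𝓝 x) := by
  choose m hm hcut using fun K => exists_isCutLevel hx (K + 1)
  refine ⟨fun K => graftPoint (x : ℝ × (ℕ → ℤ)).2 (2 * m K ^ 2) (m K - n - 1), fun K => ?_, ?_⟩
  · have := hm K
    exact ⟨graftPoint_mem_Xfan (by omega) (hcut K),
      graftPoint_notMem_closure_Xfan _ (by omega)⟩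
  · refine tendsto_graftPoint x (fun K => ?_) fun K => ?_
    · have := hm K
      omega
    · have := hm K
      have : m K ≤ m K ^ 2 := Nat.le_self_pow (by norm_num) _
      omega

/-- cl(Xₙ) is nowhere dense in the subspace cl(X_{n+1}) of E(𝓕);
equivalently, every point of Xₙ is the limit of a sequence of points of X_{n+1} \ cl(Xₙ). -/
theorem closure_Xfan_nowhereDense_in_next (n : ℕ) :
    IsNowhereDense {y : ↥(closure (Xfan (n + 1))) | (y : ↥Efan) ∈ closure (Xfan n)} ∧
    ∀ x ∈ Xfan n, ∃ u : ℕ → ↥Efan,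
      (∀ m, u m ∈ Xfan (n + 1) \ closure (Xfan n)) ∧
      Filter.Tendsto u Filter.atTop (nhds x) := by
  refine ⟨?_, fun x hx => exists_seq_tendsto_of_mem_Xfan hx⟩
  have hc : IsClosed {y : ↥(closure (Xfan (n + 1))) | (y : ↥Efan) ∈ closure (Xfan n)} :=
    isClosed_closure.preimage continuous_subtype_val
  rw [IsNowhereDense, hc.closure_eq, Set.eq_empty_iff_forall_notMem]
  intro y hy
  obtain ⟨V, hVsub, hV, hyV⟩ := mem_interior.1 hy
  obtain ⟨U, hU, rfl⟩ := isOpen_induced_iff.1 hV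
  obtain ⟨x, hxU, hx⟩ := mem_closure_iff.1 (hVsub hyV) U hU hyV
  obtain ⟨u, hu, hlim⟩ := exists_seq_tendsto_of_mem_Xfan hx
  obtain ⟨m, hm⟩ := (hlim.eventually (hU.mem_nhds hxU)).exists
  have hmem : (⟨u m, subset_closure (hu m).1⟩ : ↥(closure (Xfan (n + 1)))) ∈
      {y : ↥(closure (Xfan (n + 1))) | (y : ↥Efan) ∈ closure (Xfan n)} := hVsub hm
  exact (hu m).2 hmem
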